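/- Let d be a soft metric on X with parameter set E, ρ a soft metric on Y with parameter set E', and let g : X × E → Y × E' be the map induced by f : X → Y and φ : E → E', i.e. g (x, λ) = (f x, φ λ). Then g is soft continuous at every soft point if and only if for every set T ⊆ Y × E', the soft closure of the preimage g⁻¹(T) is contained in the preimage of the soft closure of T. -/

import Mathlib

/-- A soft metric on `X` with parameter set `E`. -/
def IsSoftMetric {X E : Type*} (d : X × E → X × E → E → ℝ) : Prop :=
  (∀ p q : X × E, ∀ e : E, 0 ≤ d p q e) ∧
  (∀ p q : X × E, (∀ e : E, d p q e = 0) ↔ p = q) ∧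
  (∀ p q : X × E, d p q = d q p) ∧
  (∀ p q r : X × E, ∀ e : E, d p r e ≤ d p q e + d q r e)

/-- The soft open ball of center `p` and radius `ε`. -/
def SoftBall {X E : Type*} (d : X × E → X × E → E → ℝ) (p : X × E) (ε : E → ℝ) :
    Set (X × E) :=
  {q | ∀ e : E, d p q e < ε e}

/-- A set is soft open if every point has a soft ball around it inside the set. -/
def SoftOpen {X E : Type*} (d : X × E → X × E → E → ℝ) (U : Set (X × E)) : Prop :=
  ∀ p ∈ U, ∃ ε : E → ℝ, (∀ e : E, 0 < ε e) ∧ SoftBall d p ε ⊆ U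

/-- A set is soft closed if its complement is soft open. -/
def SoftClosed {X E : Type*} (d : X × E → X × E → E → ℝ) (C : Set (X × E)) : Prop :=
  SoftOpen d Cᶜ

/-- The soft closure of a set: intersection of all soft closed supersets. -/
def SoftClosure {X E : Type*} (d : X × E → X × E → E → ℝ) (S : Set (X × E)) :
    Set (X × E) :=
  ⋂₀ {C | SoftClosed d C ∧ S ⊆ C}

/-- The soft interior of a set: union of all soft open subsets. -/
def SoftInterior {X E : Type*} (d : X × E → X × E → E → ℝ) (S : Set (X × E)) :
    Set (X × E) :=
  ⋃₀ {U | SoftOpen d U ∧ U ⊆ S}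

/-- Soft continuity of `g` at the soft point `p`. -/
def SoftContinuousAt {X E Y E' : Type*} (d : X × E → X × E → E → ℝ)
    (ρ : Y × E' → Y × E' → E' → ℝ) (g : X × E → Y × E') (p : X × E) : Prop :=
  ∀ ε : E' → ℝ, (∀ e' : E', 0 < ε e') → ∃ δ : E → ℝ, (∀ e : E, 0 < δ e) ∧
    ∀ q : X × E, (∀ e : E, d p q e < δ e) → (∀ e' : E', ρ (g p) (g q) e' < ε e')

/-- Soft convergence of a sequence of soft points. -/
def SoftTendsto {X E : Type*} (d : X × E → X × E → E → ℝ) (s : ℕ → X × E)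
    (p : X × E) : Prop :=
  ∀ ε : E → ℝ, (∀ e : E, 0 < ε e) → ∃ N : ℕ, ∀ n ≥ N, ∀ e : E, d (s n) p e < ε e

/-- A soft Cauchy sequence. -/
def SoftCauchy {X E : Type*} (d : X × E → X × E → E → ℝ) (s : ℕ → X × E) : Prop :=
  ∀ ε : E → ℝ, (∀ e : E, 0 < ε e) → ∃ N : ℕ, ∀ m ≥ N, ∀ n ≥ N, ∀ e : E,
    d (s m) (s n) e < ε e

/-- Completeness of the soft metric space. -/
def SoftComplete {X E : Type*} (d : X × E → X × E → E → ℝ) : Prop :=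
  ∀ s : ℕ → X × E, SoftCauchy d s → ∃ p : X × E, SoftTendsto d s p

/-- Soft open balls are soft open. -/
theorem IsSoftMetric.softOpen_softBall {X E : Type*} {d : X × E → X × E → E → ℝ}
    (hd : IsSoftMetric d) (p : X × E) (ε : E → ℝ) : SoftOpen d (SoftBall d p ε) := by
  intro q hq
  refine ⟨fun e => ε e - d p q e, fun e => sub_pos.mpr (hq e), fun r hr e => ?_⟩
  linarith [hr e, hd.2.2.2 p q r e]

/-- The center of a soft ball of positive radius belongs to it. -/
theorem IsSoftMetric.mem_softBall_self {X E : Type*} {d : X × E → X × E → E → ℝ}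
    (hd : IsSoftMetric d) (p : X × E) {ε : E → ℝ} (hε : ∀ e, 0 < ε e) :
    p ∈ SoftBall d p ε := by
  intro e
  rw [(hd.2.1 p p).mpr rfl e]
  exact hε e

/-- The preimage of a soft open set under a soft continuous map is soft open. -/
theorem SoftOpen.preimage {X E Y E' : Type*} {d : X × E → X × E → E → ℝ}
    {ρ : Y × E' → Y × E' → E' → ℝ} {g : X × E → Y × E'}
    (hg : ∀ p, SoftContinuousAt d ρ g p) {U : Set (Y × E')} (hU : SoftOpen ρ U) :
    SoftOpen d (g ⁻¹' U) := by
  intro p hp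
  obtain ⟨ε, hε, hεU⟩ := hU (g p) hp
  obtain ⟨δ, hδ, hδε⟩ := hg p ε hε
  exact ⟨δ, hδ, fun q hq => hεU (hδε q hq)⟩

/-- soft continuity iff closure of preimage is contained in preimage of closure. -/
theorem softContinuous_iff_closure_preimage {X E Y E' : Type*}
    [Nonempty X] [Nonempty E] [Nonempty Y] [Nonempty E']
    (d : X × E → X × E → E → ℝ) (hd : IsSoftMetric d)
    (ρ : Y × E' → Y × E' → E' → ℝ) (hρ : IsSoftMetric ρ)
    (f : X → Y) (φ : E → E') (g : X × E → Y × E')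
    (hg : ∀ p : X × E, g p = (f p.1, φ p.2)) :
    (∀ p : X × E, SoftContinuousAt d ρ g p) ↔
      ∀ T : Set (Y × E'), SoftClosure d (g ⁻¹' T) ⊆ g ⁻¹' (SoftClosure ρ T) := by
  constructor
  · intro h T p hp C ⟨hC, hTC⟩
    exact hp (g ⁻¹' C) ⟨SoftOpen.preimage h hC, Set.preimage_mono hTC⟩
  · intro h p ε hε
    have hclosed : SoftClosed ρ (SoftBall ρ (g p) ε)ᶜ := by
      simpa only [SoftClosed, compl_compl] using hρ.softOpen_softBall (g p) ε
    have hp : p ∉ SoftClosure d (g ⁻¹' (SoftBall ρ (g p) ε)ᶜ) := fun hp =>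
      h _ hp _ ⟨hclosed, subset_rfl⟩ (hρ.mem_softBall_self (g p) hε)
    simp only [SoftClosure, Set.mem_sInter, not_forall] at hp
    obtain ⟨C, ⟨hC, hsub⟩, hpC⟩ := hp
    obtain ⟨δ, hδ, hδC⟩ := hC p hpC
    refine ⟨δ, hδ, fun q hq => ?_⟩
    by_contra hn
    exact hδC hq (hsub hn)
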